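/- arXiv:0912.1553 — 2 statements merged into one kernel-verified Lean document; each statement's English description precedes it below -/
import Mathlib

section
/- The 7-sphere structure functions are totally antisymmetric as functions on S⁷: for all nonzero i, j, k ∈ G = (ℤ/2)³, c_{ijk} ≡ −c_{jik} (mod I) and c_{ijk} ≡ −c_{ikj} (mod I); hence c_{σ(i)σ(j)σ(k)} ≡ sgn(σ)·c_{ijk} (mod I) for every permutation σ of the three indices. -/
open MvPolynomial

/-- The group `G = (ℤ/2)³` of labels. -/
abbrev G3 : Type := Fin 3 → ZMod 2

/-- The octonion cochain `F(a,b) = (−1)^{∑_{i≤j} aᵢbⱼ + a₁a₂b₃ + a₁b₂a₃ + b₁a₂a₃}`,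
with components read as representatives in `{0,1}`. -/
def octF (a b : G3) : ℝ :=
  (-1) ^ ((a 0).val * (b 0).val + (a 0).val * (b 1).val + (a 0).val * (b 2).val
    + (a 1).val * (b 1).val + (a 1).val * (b 2).val + (a 2).val * (b 2).val
    + (a 0).val * (a 1).val * (b 2).val + (a 0).val * (b 1).val * (a 2).val
    + (b 0).val * (a 1).val * (a 2).val)

/-- The octonion associator `φ(a,b,c) = (−1)^{a·(b×c)}`, with the triple product
computed in `ℤ/2`. -/
def octPhi (a b c : G3) : ℝ :=
  (-1) ^ (a 0 * (b 1 * c 2 + b 2 * c 1) + a 1 * (b 2 * c 0 + b 0 * c 2)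
    + a 2 * (b 0 * c 1 + b 1 * c 0)).val

/-- The polynomial ring `R = ℝ[x_a : a ∈ G]` in eight variables indexed by `G`. -/
noncomputable abbrev R8 : Type := MvPolynomial G3 ℝ

/-- The structure functions `c_{ijk}` of the left-invariant coframe of `k(S⁷)`:
`c_{ijk} = −F(i,j)F(i+j,k) ∑_a φ(a,i,j) φ(a,i+j,k) F(a,i+j+k) x_a x_{a+i+j+k}`. -/
noncomputable def cS (i j k : G3) : R8 :=
  C (-(octF i j * octF (i + j) k)) *
    ∑ a : G3, C (octPhi a i j * octPhi a (i + j) k * octF a (i + j + k)) *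
      (X a * X (a + i + j + k))

/-- The 7-sphere ideal, generated by `∑_a x_a² − 1`. -/
noncomputable def sphere7 : Ideal R8 :=
  Ideal.span {(∑ a : G3, X a ^ 2) - 1}

/-- The left-invariant vector field `∂_i`, the derivation of `R` with
`∂_i x_a = −F(a,i) x_{a+i}`. -/
noncomputable def pder (i : G3) : Derivation ℝ R8 R8 :=
  MvPolynomial.mkDerivation ℝ fun a => - C (octF a i) * X (a + i)

/-- The integer sign whose real value is `octF a b`. -/
def octFInt (a b : G3) : ℤ :=
  (-1) ^ ((a 0).val * (b 0).val + (a 0).val * (b 1).val + (a 0).val * (b 2).val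
    + (a 1).val * (b 1).val + (a 1).val * (b 2).val + (a 2).val * (b 2).val
    + (a 0).val * (a 1).val * (b 2).val + (a 0).val * (b 1).val * (a 2).val
    + (b 0).val * (a 1).val * (a 2).val)

/-- The integer sign whose real value is `octPhi a b c`. -/
def octPhiInt (a b c : G3) : ℤ :=
  (-1) ^ (a 0 * (b 1 * c 2 + b 2 * c 1) + a 1 * (b 2 * c 0 + b 0 * c 2)
    + a 2 * (b 0 * c 1 + b 1 * c 0)).val

theorem octF_eq_intCast (a b : G3) : octF a b = octFInt a b := by
  simp [octF, octFInt]

theorem octPhi_eq_intCast (a b c : G3) : octPhi a b c = octPhiInt a b c := by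
  simp [octPhi, octPhiInt]

theorem octF_swap {a b : G3} (ha : a ≠ 0) (hb : b ≠ 0) (hab : a ≠ b) :
    octF b a = -octF a b := by
  have h : ∀ a b : G3, a ≠ 0 → b ≠ 0 → a ≠ b → octFInt b a = -octFInt a b := by
    decide +kernel
  rw [octF_eq_intCast, octF_eq_intCast]
  exact_mod_cast h a b ha hb hab

theorem octF_add_right_self (a : G3) {b : G3} (hb : b ≠ 0) :
    octF (a + b) b = -octF a b := by
  have h : ∀ a b : G3, b ≠ 0 → octFInt (a + b) b = -octFInt a b := by
    decide +kernel
  rw [octF_eq_intCast, octF_eq_intCast]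
  exact_mod_cast h a b hb

/-- The associator is the coboundary of the cochain. -/
theorem octF_mul_octF_add (a b c : G3) :
    octF a b * octF (a + b) c = octPhi a b c * (octF b c * octF a (b + c)) := by
  have h : ∀ a b c : G3, octFInt a b * octFInt (a + b) c =
      octPhiInt a b c * (octFInt b c * octFInt a (b + c)) := by
    decide +kernel
  simp only [octF_eq_intCast, octPhi_eq_intCast]
  exact_mod_cast h a b c

theorem octPhi_swap (a b c : G3) : octPhi a c b = octPhi a b c := by
  simp only [octPhi]
  congr 2
  ring

theorem octPhi_self (a b : G3) : octPhi a b b = 1 := by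
  have h : a 0 * (b 1 * b 2 + b 2 * b 1) + a 1 * (b 2 * b 0 + b 0 * b 2)
      + a 2 * (b 0 * b 1 + b 1 * b 0) = 0 := by
    simp only [mul_comm (b 2) (b 1), mul_comm (b 0) (b 2), mul_comm (b 1) (b 0),
      CharTwo.add_self_eq_zero, mul_zero]
  simp [octPhi, h]

theorem octPhi_add (a b c d : G3) :
    octPhi a (b + c) d = octPhi a b d * octPhi a c d := by
  have h : ∀ x y : ZMod 2, ((-1) ^ (x + y).val : ℤ) = (-1) ^ x.val * (-1) ^ y.val := by
    decide
  have h' (x y : ZMod 2) : ((-1) ^ (x + y).val : ℝ) = (-1) ^ x.val * (-1) ^ y.val := by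
    exact_mod_cast h x y
  simp only [octPhi, ← h', Pi.add_apply]
  congr 2
  ring

theorem octPhi_zero (a b : G3) : octPhi a 0 b = 1 := by
  simp [octPhi]

theorem octPhi_mul_self (a b c : G3) : octPhi a b c * octPhi a b c = 1 := by
  rw [← octPhi_add, CharTwo.add_self_eq_zero, octPhi_zero]

/-- The coefficient of the `a`-th summand of `cS i j k`. -/
noncomputable def cSCoeff (i j k a : G3) : ℝ :=
  -(octF i j * octF (i + j) k) *
    (octPhi a i j * octPhi a (i + j) k * octF a (i + j + k))

theorem cS_eq_sum (i j k : G3) :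
    cS i j k = ∑ a : G3, C (cSCoeff i j k a) * (X a * X (a + (i + j + k))) := by
  rw [cS, Finset.mul_sum]
  refine Finset.sum_congr rfl fun a _ => ?_
  rw [cSCoeff, ← mul_assoc, ← C_mul]
  simp only [add_assoc]

/-- A quadratic form `∑ f(a) x_a x_{a+s}` vanishes if `f(a) + f(a+s) = 0` for all `a`. -/
theorem sum_mul_X_mul_X_eq_zero (s : G3) (f : G3 → ℝ) (hf : ∀ a, f a + f (a + s) = 0) :
    ∑ a : G3, C (f a) * (X a * X (a + s)) = (0 : R8) := by
  have hs : s + s = 0 := CharTwo.add_self_eq_zero s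
  have hshift : ∑ a : G3, C (f a) * (X a * X (a + s))
      = (∑ a : G3, C (f (a + s)) * (X a * X (a + s)) : R8) := by
    rw [← Equiv.sum_comp (Equiv.addRight s)]
    refine Finset.sum_congr rfl fun a _ => ?_
    simp only [Equiv.coe_addRight, add_assoc, hs, add_zero]
    ring
  refine self_eq_neg.mp ?_
  nth_rewrite 1 [hshift]
  rw [← Finset.sum_neg_distrib]
  refine Finset.sum_congr rfl fun a _ => ?_
  rw [eq_neg_of_add_eq_zero_right (hf a), C_neg, neg_mul]

theorem cS_self_left (i : G3) {k : G3} (hk : k ≠ 0) : cS i i k = 0 := by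
  rw [cS_eq_sum]
  refine sum_mul_X_mul_X_eq_zero _ _ fun a => ?_
  simp only [cSCoeff, CharTwo.add_self_eq_zero, zero_add, octPhi_self, octPhi_zero,
    octF_add_right_self a hk]
  ring

theorem cS_self_right {i : G3} (hi : i ≠ 0) (j : G3) : cS i j j = 0 := by
  rw [cS_eq_sum]
  refine sum_mul_X_mul_X_eq_zero _ _ fun a => ?_
  simp only [cSCoeff, add_assoc, CharTwo.add_self_eq_zero, add_zero, octPhi_add a i j,
    octPhi_add (a + i) i j, octPhi_self, mul_one, octPhi_mul_self,
    octF_add_right_self a hi]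
  ring

theorem cS_swap_left {i j k : G3} (hi : i ≠ 0) (hj : j ≠ 0) (hk : k ≠ 0) :
    cS j i k = -cS i j k := by
  rcases eq_or_ne i j with rfl | hij
  · rw [cS_self_left i hk, neg_zero]
  · rw [cS_eq_sum, cS_eq_sum, ← Finset.sum_neg_distrib]
    refine Finset.sum_congr rfl fun a _ => ?_
    have hc : cSCoeff j i k a = -cSCoeff i j k a := by
      rw [cSCoeff, cSCoeff, octF_swap hi hj hij, octPhi_swap a i j, add_comm j i]
      ring
    rw [hc, C_neg, neg_mul, add_comm j i]

theorem cS_swap_right {i j k : G3} (hi : i ≠ 0) (hj : j ≠ 0) (hk : k ≠ 0) :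
    cS i k j = -cS i j k := by
  rcases eq_or_ne j k with rfl | hjk
  · rw [cS_self_right hi j, neg_zero]
  · rw [cS_eq_sum, cS_eq_sum, ← Finset.sum_neg_distrib]
    refine Finset.sum_congr rfl fun a _ => ?_
    have hc : cSCoeff i k j a = -cSCoeff i j k a := by
      rw [cSCoeff, cSCoeff, octF_mul_octF_add, octF_mul_octF_add, octF_swap hj hk hjk,
        octPhi_swap i j k, octPhi_add, octPhi_add, octPhi_swap a j k, add_comm k j,
        add_right_comm i k j]
      ring
    rw [hc, C_neg, neg_mul, add_right_comm i k j]

theorem perm_fin_three_cases : ∀ σ : Equiv.Perm (Fin 3),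
    (σ 0 = 0 ∧ σ 1 = 1 ∧ σ 2 = 2 ∧ (Equiv.Perm.sign σ : ℤ) = 1) ∨
    (σ 0 = 1 ∧ σ 1 = 0 ∧ σ 2 = 2 ∧ (Equiv.Perm.sign σ : ℤ) = -1) ∨
    (σ 0 = 0 ∧ σ 1 = 2 ∧ σ 2 = 1 ∧ (Equiv.Perm.sign σ : ℤ) = -1) ∨
    (σ 0 = 2 ∧ σ 1 = 1 ∧ σ 2 = 0 ∧ (Equiv.Perm.sign σ : ℤ) = -1) ∨
    (σ 0 = 1 ∧ σ 1 = 2 ∧ σ 2 = 0 ∧ (Equiv.Perm.sign σ : ℤ) = 1) ∨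
    (σ 0 = 2 ∧ σ 1 = 0 ∧ σ 2 = 1 ∧ (Equiv.Perm.sign σ : ℤ) = 1) := by
  decide

/-- the 7-sphere structure functions are totally antisymmetric on `S⁷`:
for nonzero `i,j,k`, `c_{ijk} ≡ −c_{jik}` and `c_{ijk} ≡ −c_{ikj} (mod I)`; hence
`c_{σ(i)σ(j)σ(k)} ≡ sgn(σ)·c_{ijk} (mod I)` for every permutation `σ`. -/
theorem s7_structure_antisymmetric (i j k : G3) (hi : i ≠ 0) (hj : j ≠ 0) (hk : k ≠ 0) :
    (cS i j k + cS j i k ∈ sphere7) ∧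
    (cS i j k + cS i k j ∈ sphere7) ∧
    ∀ σ : Equiv.Perm (Fin 3),
      cS (![i, j, k] (σ 0)) (![i, j, k] (σ 1)) (![i, j, k] (σ 2))
        - (Equiv.Perm.sign σ : ℤ) • cS i j k ∈ sphere7 := by
  have hl : cS j i k = -cS i j k := cS_swap_left hi hj hk
  have hr : cS i k j = -cS i j k := cS_swap_right hi hj hk
  have hlr : cS j k i = cS i j k := by rw [cS_swap_right hj hi hk, hl, neg_neg]
  have hrl : cS k i j = cS i j k := by rw [cS_swap_left hi hk hj, hr, neg_neg]
  have hlrl : cS k j i = -cS i j k := by rw [cS_swap_left hj hk hi, hlr]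
  refine ⟨by simp [hl], by simp [hr], fun σ => ?_⟩
  rcases perm_fin_three_cases σ with
    ⟨h0, h1, h2, hs⟩ | ⟨h0, h1, h2, hs⟩ | ⟨h0, h1, h2, hs⟩ | ⟨h0, h1, h2, hs⟩ |
      ⟨h0, h1, h2, hs⟩ | ⟨h0, h1, h2, hs⟩ <;>
    rw [h0, h1, h2, hs] <;> simp [hl, hr, hlr, hrl, hlrl]
end

section
/- The octonionic 7-sphere is an Einstein space with Ricci = −3g: for all nonzero n, k ∈ G = (ℤ/2)³, Σ_{i,j ∈ G∖{0}} c_{inj}·c_{jki} − Σ_{i ∈ G∖{0}} ∂_i c_{ink} ≡ −6·δ_{nk} modulo the 7-sphere ideal I. (Equivalently, the Ricci tensor Ricci = ½(cⁱ_{nj} cʲ_{ki} − ∂_i cⁱ_{nk}) ωⁿ⊗ωᵏ of the Levi-Civita connection ∇ωⁱ = −cⁱ_{jk} ωʲ⊗ωᵏ for the metric g = δ_{ij} ωⁱ⊗ωʲ equals −3g.) -/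
open MvPolynomial

/-- The octonion cochain with values in `ℤ`. -/
def octSign (a b : G3) : ℤ :=
  (-1) ^ ((a 0).val * (b 0).val + (a 0).val * (b 1).val + (a 0).val * (b 2).val
    + (a 1).val * (b 1).val + (a 1).val * (b 2).val + (a 2).val * (b 2).val
    + (a 0).val * (a 1).val * (b 2).val + (a 0).val * (b 1).val * (a 2).val
    + (b 0).val * (a 1).val * (a 2).val)

/-- The octonion associator with values in `ℤ`. -/
def octAssocSign (a b c : G3) : ℤ :=
  (-1) ^ (a 0 * (b 1 * c 2 + b 2 * c 1) + a 1 * (b 2 * c 0 + b 0 * c 2)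
    + a 2 * (b 0 * c 1 + b 1 * c 0)).val

lemma octF_eq_octSign (a b : G3) : octF a b = octSign a b := by
  simp [octF, octSign]

lemma octPhi_eq_octAssocSign (a b c : G3) : octPhi a b c = octAssocSign a b c := by
  simp [octPhi, octAssocSign]

lemma G3.add_self (a : G3) : a + a = 0 := by
  funext t
  exact CharTwo.add_self_eq_zero (a t)

lemma G3.add_add_cancel (a b : G3) : a + b + b = a := by
  rw [add_assoc, G3.add_self, add_zero]

lemma octSign_mul_self (a b : G3) : octSign a b * octSign a b = 1 := by
  simp [octSign, ← mul_pow]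

lemma octSign_zero_right (a : G3) : octSign a 0 = 1 := by
  simp [octSign]

lemma octSign_skew : ∀ a i : G3, i ≠ 0 → octSign (a + i) i = -octSign a i := by
  decide +kernel

lemma octSign_anticomm : ∀ a i j : G3, i ≠ 0 → j ≠ 0 → i ≠ j →
    octSign (a + i + j) i * octSign (a + j) j = -(octSign (a + j + i) j * octSign (a + i) i) := by
  decide +kernel

lemma octSign_orthogonal : ∀ a b k : G3, a ≠ b →
    octSign (a + (k + (a + b))) (k + (a + b)) * octSign (b + (k + (a + b))) (k + (a + b)) =
      -(octSign (a + k) k * octSign (b + k) k) := by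
  decide +kernel

/-- The associator is the coboundary of the octonion cochain. -/
lemma octSign_coboundary : ∀ a b c : G3,
    octSign b c * octAssocSign a b c * octSign a (b + c) = octSign a b * octSign (a + b) c := by
  decide +kernel

lemma octSign_mul_three (a i j k : G3) :
    octSign i j * octSign (i + j) k *
        (octAssocSign a i j * octAssocSign a (i + j) k * octSign a (i + j + k)) =
      octSign a i * octSign (a + i) j * octSign (a + i + j) k := by
  have h₁ := octSign_coboundary a i j
  have h₂ := octSign_coboundary a (i + j) k
  rw [← add_assoc] at h₂
  linear_combination (octSign i j * octAssocSign a i j) * h₂ + octSign (a + i + j) k * h₁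

section RightMultiplication

variable {A : Type*} [CommRing A]

/-- Right multiplication by the octonion unit `e_i`, in coordinates. -/
def octRight (i : G3) (u : G3 → A) : G3 → A := fun a => (octSign (a + i) i : A) * u (a + i)

lemma octRight_zero (u : G3 → A) : octRight 0 u = u := by
  funext a
  simp [octRight, octSign_zero_right]

lemma octRight_neg (i : G3) (u : G3 → A) : octRight i (-u) = -octRight i u := by
  funext a
  simp [octRight]

lemma octRight_octRight_self {i : G3} (hi : i ≠ 0) (u : G3 → A) :
    octRight i (octRight i u) = -u := by
  funext a
  have h := congrArg (Int.cast : ℤ → A) (octSign_mul_self a i)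
  push_cast at h
  simp only [octRight, G3.add_add_cancel, octSign_skew a i hi, Pi.neg_apply]
  push_cast
  linear_combination (-u a) * h

lemma octRight_anticomm {i j : G3} (hi : i ≠ 0) (hj : j ≠ 0) (hij : i ≠ j) (u : G3 → A) :
    octRight i (octRight j u) = -octRight j (octRight i u) := by
  funext a
  have h : (octSign (a + i + j) j : A) * octSign (a + i) i =
      -(octSign (a + j + i) i * octSign (a + j) j) := by
    have := octSign_anticomm a j i hj hi hij.symm
    rw [add_right_comm a j i, octSign_skew (a + i) j hj, add_right_comm a i j,
      octSign_skew (a + j) i hi] at this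
    have := congrArg (Int.cast : ℤ → A) this
    push_cast at this
    rw [octSign_skew (a + i) j hj, octSign_skew (a + j) i hi]
    push_cast
    exact this
  simp only [octRight, Pi.neg_apply, add_right_comm a j i] at h ⊢
  linear_combination u (a + i + j) * h

lemma dotProduct_octRight {i : G3} (hi : i ≠ 0) (u w : G3 → A) :
    u ⬝ᵥ octRight i w = -(octRight i u ⬝ᵥ w) := by
  simp only [dotProduct, octRight, ← Finset.sum_neg_distrib]
  rw [← Equiv.sum_comp (Equiv.addRight i)]
  refine Finset.sum_congr rfl fun a _ => ?_
  simp only [Equiv.coe_addRight, G3.add_add_cancel, octSign_skew a i hi]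
  push_cast
  ring

variable [IsDomain A] [CharZero A]

lemma dotProduct_octRight_self {i : G3} (hi : i ≠ 0) (u : G3 → A) : u ⬝ᵥ octRight i u = 0 :=
  self_eq_neg.mp ((dotProduct_octRight hi u u).trans (by rw [dotProduct_comm]))

lemma octRight_dotProduct_octRight {n k : G3} (hn : n ≠ 0) (hk : k ≠ 0) (u : G3 → A) :
    octRight n u ⬝ᵥ octRight k u = if n = k then u ⬝ᵥ u else 0 := by
  split_ifs with h
  · subst h
    rw [dotProduct_octRight hn, octRight_octRight_self hn, neg_dotProduct, neg_neg]
  · refine self_eq_neg.mp ?_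
    calc octRight n u ⬝ᵥ octRight k u
        = -(octRight k (octRight n u) ⬝ᵥ u) := dotProduct_octRight hk _ _
      _ = octRight n (octRight k u) ⬝ᵥ u := by
        rw [octRight_anticomm hk hn (Ne.symm h), neg_dotProduct, neg_neg]
      _ = -(octRight n u ⬝ᵥ octRight k u) := by
        rw [dotProduct_comm, dotProduct_octRight hn]

lemma sum_octRight_mul_octRight (x : G3 → A) (a b : G3) :
    ∑ k, octRight k x a * octRight k x b = if a = b then x ⬝ᵥ x else 0 := by
  split_ifs with h
  · subst h
    conv_rhs => rw [dotProduct, ← Equiv.sum_comp (Equiv.addLeft a)]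
    refine Finset.sum_congr rfl fun k _ => ?_
    have h : (octSign (a + k) k : A) * octSign (a + k) k = 1 :=
      mod_cast octSign_mul_self (a + k) k
    simp only [octRight, Equiv.coe_addLeft]
    linear_combination x (a + k) * x (a + k) * h
  · refine self_eq_neg.mp ?_
    conv_lhs => rw [← Equiv.sum_comp (Equiv.addRight (a + b))]
    rw [← Finset.sum_neg_distrib]
    refine Finset.sum_congr rfl fun k _ => ?_
    have hs := congrArg (Int.cast : ℤ → A) (octSign_orthogonal a b k h)
    push_cast at hs
    have ha : a + (k + (a + b)) = b + k := by
      rw [show a + (k + (a + b)) = b + k + a + a by abel, G3.add_add_cancel]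
    have hb : b + (k + (a + b)) = a + k := by
      rw [show b + (k + (a + b)) = a + k + b + b by abel, G3.add_add_cancel]
    simp only [octRight, Equiv.coe_addRight, ha, hb] at hs ⊢
    linear_combination x (a + k) * x (b + k) * hs

/-- Parseval's identity for the orthogonal frame `x e_k`. -/
lemma sum_dotProduct_octRight_mul (x u w : G3 → A) :
    ∑ k, (octRight k x ⬝ᵥ u) * (octRight k x ⬝ᵥ w) = (x ⬝ᵥ x) * (u ⬝ᵥ w) := by
  calc ∑ k, (octRight k x ⬝ᵥ u) * (octRight k x ⬝ᵥ w)
      = ∑ a, ∑ b, (∑ k, octRight k x a * octRight k x b) * (u a * w b) := by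
        simp_rw [dotProduct, Finset.sum_mul_sum, Finset.sum_mul]
        rw [Finset.sum_comm]
        refine Finset.sum_congr rfl fun a _ => ?_
        rw [Finset.sum_comm]
        exact Finset.sum_congr rfl fun b _ => Finset.sum_congr rfl fun k _ => by ring
    _ = (x ⬝ᵥ x) * (u ⬝ᵥ w) := by
        simp only [sum_octRight_mul_octRight, ite_mul, zero_mul, Finset.sum_ite_eq,
          Finset.mem_univ, if_true]
        rw [dotProduct_comm u w, ← Finset.mul_sum, dotProduct_comm w u]
        rfl

lemma sum_erase_dotProduct_octRight_mul (x u w : G3 → A) :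
    ∑ k ∈ Finset.univ.erase (0 : G3), (octRight k x ⬝ᵥ u) * (octRight k x ⬝ᵥ w) =
      (x ⬝ᵥ x) * (u ⬝ᵥ w) - (x ⬝ᵥ u) * (x ⬝ᵥ w) := by
  rw [← sum_dotProduct_octRight_mul, ← Finset.add_sum_erase _ _ (Finset.mem_univ (0 : G3)),
    octRight_zero]
  ring

lemma sum_erase_frame_mul {n k : G3} (hn : n ≠ 0) (hk : k ≠ 0) (x : G3 → A) :
    ∑ i ∈ Finset.univ.erase (0 : G3), ∑ j ∈ Finset.univ.erase (0 : G3),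
        (octRight j x ⬝ᵥ octRight n (octRight i x)) *
          (octRight j x ⬝ᵥ octRight k (octRight i x)) =
      if n = k then 6 * (x ⬝ᵥ x) ^ 2 else 0 := by
  have key : ∀ i ∈ Finset.univ.erase (0 : G3), ∑ j ∈ Finset.univ.erase (0 : G3),
      (octRight j x ⬝ᵥ octRight n (octRight i x)) *
        (octRight j x ⬝ᵥ octRight k (octRight i x)) =
      (if n = k then (x ⬝ᵥ x) ^ 2 else 0) -
        if n = i then (if n = k then (x ⬝ᵥ x) ^ 2 else 0) else 0 := by
    intro i hi
    have hi := Finset.ne_of_mem_erase hi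
    rw [sum_erase_dotProduct_octRight_mul, octRight_dotProduct_octRight hn hk,
      octRight_dotProduct_octRight hi hi, dotProduct_octRight hn x, dotProduct_octRight hk x,
      octRight_dotProduct_octRight hn hi, octRight_dotProduct_octRight hk hi, if_pos rfl]
    split_ifs <;> first | ring1 | (exfalso; simp_all)
  rw [Finset.sum_congr rfl key, Finset.sum_sub_distrib, Finset.sum_const, Finset.sum_ite_eq,
    if_pos (Finset.mem_erase.mpr ⟨hn, Finset.mem_univ n⟩),
    Finset.card_erase_of_mem (Finset.mem_univ _), Finset.card_univ]
  simp only [Fintype.card_pi, ZMod.card, Finset.prod_const, Finset.card_univ, Fintype.card_fin]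
  split_ifs
  · rw [nsmul_eq_mul]
    push_cast
    ring
  · simp

end RightMultiplication

lemma cS_eq_dotProduct (i j k : G3) :
    cS i j k = -(octRight k (octRight j (octRight i X)) ⬝ᵥ (X : G3 → R8)) := by
  rw [dotProduct, ← Equiv.sum_comp (Equiv.addRight (i + j + k)), cS, Finset.mul_sum,
    ← Finset.sum_neg_distrib]
  refine Finset.sum_congr rfl fun a _ => ?_
  have h := congrArg (Int.cast : ℤ → R8) (octSign_mul_three a i j k)
  push_cast at h
  simp only [octRight, Equiv.coe_addRight, octF_eq_octSign, octPhi_eq_octAssocSign,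
    ← add_assoc, G3.add_add_cancel, map_mul, map_neg, map_intCast]
  linear_combination (-X a * X (a + i + j + k)) * h

lemma cS_eq_frame {i j k : G3} (hk : k ≠ 0) :
    cS i j k = (octRight k X ⬝ᵥ octRight j (octRight i (X : G3 → R8))) := by
  rw [cS_eq_dotProduct, dotProduct_comm, dotProduct_octRight hk, neg_neg]

lemma pder_X {i : G3} (hi : i ≠ 0) (a : G3) : pder i (X a) = octRight i X a := by
  simp [pder, mkDerivation_X, octRight, octSign_skew a i hi, octF_eq_octSign]

lemma Derivation.map_octRight (D : Derivation ℝ R8 R8) (i : G3) (u : G3 → R8) (a : G3) :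
    D (octRight i u a) = octRight i (fun b => D (u b)) a := by
  simp [octRight, Derivation.leibniz]

lemma Derivation.map_dotProduct (D : Derivation ℝ R8 R8) (u w : G3 → R8) :
    D (u ⬝ᵥ w) = u ⬝ᵥ (fun a => D (w a)) + (fun a => D (u a)) ⬝ᵥ w := by
  simp only [dotProduct, map_sum, Derivation.leibniz, smul_eq_mul, Finset.sum_add_distrib]
  exact congrArg _ (Finset.sum_congr rfl fun a _ => mul_comm _ _)

lemma pder_cS_eq_zero {i n k : G3} (hi : i ≠ 0) (hn : n ≠ 0) (hk : k ≠ 0) :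
    pder i (cS i n k) = 0 := by
  have hX : (fun a => pder i (X a)) = octRight i (X : G3 → R8) := funext (pder_X hi)
  have hR (j : G3) (u : G3 → R8) :
      (fun a => pder i (octRight j u a)) = octRight j fun a => pder i (u a) :=
    funext (Derivation.map_octRight _ j u)
  rw [cS_eq_dotProduct, map_neg, Derivation.map_dotProduct, hR, hR, hR, hX,
    octRight_octRight_self hi, octRight_neg, octRight_neg, neg_dotProduct,
    dotProduct_comm (octRight k (octRight n X)), dotProduct_octRight hk,
    dotProduct_comm (octRight k (octRight n (octRight i X))), dotProduct_octRight hk,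
    octRight_dotProduct_octRight hk hn, octRight_dotProduct_octRight hk hn,
    octRight_dotProduct_octRight hi hi, if_pos rfl]
  ring

/-- the octonionic 7-sphere is an Einstein space with `Ricci = −3g`:
for all nonzero `n, k ∈ G`,
`∑_{i,j ≠ 0} c_{inj} c_{jki} − ∑_{i ≠ 0} ∂_i c_{ink} ≡ −6δ_{nk} (mod I)`. -/
theorem s7_einstein (n k : G3) (hn : n ≠ 0) (hk : k ≠ 0) :
    (∑ i ∈ Finset.univ.erase (0 : G3), ∑ j ∈ Finset.univ.erase (0 : G3),
        cS i n j * cS j k i)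
      - (∑ i ∈ Finset.univ.erase (0 : G3), pder i (cS i n k))
      - (if n = k then (-6 : R8) else 0) ∈ sphere7 := by
  have hc : ∀ i ∈ Finset.univ.erase (0 : G3), ∀ j ∈ Finset.univ.erase (0 : G3),
      cS i n j * cS j k i =
        -((octRight j X ⬝ᵥ octRight n (octRight i X)) *
          (octRight j X ⬝ᵥ octRight k (octRight i X))) := by
    intro i hi j hj
    rw [cS_eq_frame (Finset.ne_of_mem_erase hj), cS_eq_frame (Finset.ne_of_mem_erase hi),
      dotProduct_octRight hk (octRight i X), dotProduct_comm (octRight k (octRight i X)), mul_neg]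
  rw [Finset.sum_congr rfl fun i hi => Finset.sum_congr rfl (hc i hi),
    Finset.sum_eq_zero fun i hi => pder_cS_eq_zero (Finset.ne_of_mem_erase hi) hn hk]
  simp only [Finset.sum_neg_distrib]
  rw [sum_erase_frame_mul hn hk, sphere7, Ideal.mem_span_singleton]
  have hq : (X : G3 → R8) ⬝ᵥ X = ∑ a : G3, X a ^ 2 := by
    simp only [dotProduct, sq]
  rw [hq]
  split_ifs
  · exact ⟨-6 * ((∑ a : G3, X a ^ 2) + 1), by ring⟩
  · simp
end
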